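/- arXiv:2002.10715 — 2 statements merged into one kernel-verified Lean document; each statement's English description precedes it below -/
import Mathlib

section
/- For m > n, there is no continuous injection from ℝ^m into ℝ^n. -/
open Set Metric MeasureTheory Polynomial
open scoped NNReal ContDiff

section Jacobian

variable {E : Type*} [NormedAddCommGroup E] [NormedSpace ℝ E] [FiniteDimensional ℝ E]

/-- `t ↦ det (1 + t A)` is a polynomial of degree at most `finrank ℝ E`, written here in Lagrange
form: its coefficients depend on `A` only through the numbers `det (1 + i A)`. -/
theorem ContinuousLinearMap.det_one_add_smul_eq_sum_lagrange (A : E →L[ℝ] E) (t : ℝ) :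
    (1 + t • A).det = ∑ i ∈ Finset.range (Module.finrank ℝ E + 1),
      (1 + (i : ℝ) • A).det *
        (Lagrange.basis (Finset.range (Module.finrank ℝ E + 1)) (fun j : ℕ => (j : ℝ)) i).eval t := by
  classical
  let b := Module.finBasis ℝ E
  let M := LinearMap.toMatrix b b (A : E →ₗ[ℝ] E)
  let p : ℝ[X] := ((X : ℝ[X]) • M.map C + (1 : Matrix _ _ ℝ).map C).det
  have hp (s : ℝ) : p.eval s = (1 + s • A).det := by
    have h : (1 + s • A).det = (s • M + 1).det := by
      rw [ContinuousLinearMap.det, ← LinearMap.det_toMatrix b]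
      simp [M, add_comm]
    rw [h, ← Polynomial.coe_evalRingHom, RingHom.map_det]
    congr 1
    ext i j
    by_cases hij : i = j <;> simp [hij, mul_comm s]
  have hdeg : p.degree < (Finset.range (Module.finrank ℝ E + 1)).card := by
    refine lt_of_le_of_lt (degree_le_of_natDegree_le (natDegree_det_X_add_C_le M 1)) ?_
    simp only [Fintype.card_fin, Finset.card_range]
    exact_mod_cast Nat.lt_succ_self _
  have hinj : Set.InjOn (fun j : ℕ => (j : ℝ)) (Finset.range (Module.finrank ℝ E + 1)) :=
    Nat.cast_injective.injOn
  rw [← hp, Lagrange.eq_interpolate hinj hdeg, Lagrange.interpolate_apply, eval_finsetSum]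
  simp [hp]

theorem ContinuousLinearMap.det_one_add_smul_pos {A : E →L[ℝ] E} {L t : ℝ} (hA : ‖A‖ ≤ L)
    (ht : 0 ≤ t) (htL : t * L < 1) : 0 < (1 + t • A).det := by
  have hne : ∀ s ∈ Icc 0 t, (1 + s • A).det ≠ 0 := by
    intro s hs h
    obtain ⟨v, hv, hv0⟩ := (Submodule.ne_bot_iff _).1 (LinearMap.bot_lt_ker_of_det_eq_zero h).ne'
    have hv' : v = -(s • A v) := by
      have : v + s • A v = 0 := by simpa using hv
      exact eq_neg_of_add_eq_zero_left this
    have h1 : ‖v‖ ≤ t * L * ‖v‖ := by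
      calc ‖v‖ = s * ‖A v‖ := by
            conv_lhs => rw [hv', norm_neg, norm_smul, Real.norm_of_nonneg hs.1]
        _ ≤ t * (L * ‖v‖) := by
            gcongr
            · exact hs.2
            · exact A.le_of_opNorm_le hA v
        _ = t * L * ‖v‖ := by ring
    have := norm_pos_iff.2 hv0
    nlinarith
  by_contra! hneg
  have hcont : ContinuousOn (fun s : ℝ => (1 + s • A).det) (Icc 0 t) :=
    (ContinuousLinearMap.continuous_det.comp (by fun_prop)).continuousOn
  obtain ⟨s, hs, hs0⟩ := intermediate_value_Icc' ht hcont
    (show (0 : ℝ) ∈ _ from ⟨hneg, by simp [ContinuousLinearMap.det]⟩)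
  exact hne s hs hs0

end Jacobian

theorem image_ball_of_bijective_of_eq_self {E : Type*} [NormedAddCommGroup E]
    {T : E → E} (hT : Function.Bijective T)
    (h : ∀ x, 1 ≤ ‖x‖ → T x = x) : T '' ball 0 1 = ball 0 1 := by
  apply Subset.antisymm
  · rintro _ ⟨x, hx, rfl⟩
    by_contra hTx
    simp only [mem_ball_zero_iff, not_lt] at hx hTx
    have := hT.1 (h _ hTx)
    rw [this] at hTx
    linarith
  · intro y hy
    obtain ⟨x, rfl⟩ := hT.2 y
    refine ⟨x, ?_, rfl⟩
    by_contra hx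
    simp only [mem_ball_zero_iff, not_lt] at hx hy
    rw [h x hx] at hy
    linarith

section Perturbation

variable {E : Type*} [NormedAddCommGroup E] [NormedSpace ℝ E]

theorem LipschitzWith.of_lipschitzOnWith_closedBall_of_eq_zero {u : E → E} {L : ℝ≥0}
    (hu : LipschitzOnWith L u (closedBall 0 1)) (h0 : ∀ x, 1 ≤ ‖x‖ → u x = 0) :
    LipschitzWith L u := by
  have key : ∀ x y : E, ‖x‖ ≤ 1 → 1 ≤ ‖y‖ → ‖u x - u y‖ ≤ L * ‖x - y‖ := by
    intro x y hx hy
    obtain ⟨s, hs, hs1⟩ := intermediate_value_Icc (zero_le_one (α := ℝ))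
      (f := fun s : ℝ => ‖x + s • (y - x)‖) (by fun_prop)
      (show (1 : ℝ) ∈ _ from ⟨by simpa using hx, by simpa using hy⟩)
    simp only at hs1
    have hz := hu.norm_sub_le (x := x) (y := x + s • (y - x)) (by simpa using hx)
      (by simp [hs1])
    rw [h0 y hy]
    rw [h0 _ hs1.ge] at hz
    refine hz.trans ?_
    gcongr
    have : x - (x + s • (y - x)) = s • (x - y) := by module
    rw [this, norm_smul, Real.norm_of_nonneg hs.1]
    exact mul_le_of_le_one_left (norm_nonneg _) hs.2
  refine LipschitzWith.of_dist_le_mul fun x y => ?_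
  rw [dist_eq_norm, dist_eq_norm]
  rcases le_total ‖x‖ 1 with hx | hx <;> rcases le_total ‖y‖ 1 with hy | hy
  · exact hu.norm_sub_le (by simpa using hx) (by simpa using hy)
  · exact key x y hx hy
  · rw [norm_sub_rev, norm_sub_rev x]
    exact key y x hy hx
  · rw [h0 x hx, h0 y hy]
    simp only [sub_self, norm_zero]
    positivity

theorem LipschitzWith.bijective_add_smul [CompleteSpace E] {u : E → E} {L t : ℝ≥0}
    (hu : LipschitzWith L u) (htL : t * L < 1) :
    Function.Bijective fun x => x + t • u x := by
  have hc (y : E) : ContractingWith (t * L) fun x => y - t • u x := by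
    refine ⟨htL, LipschitzWith.of_dist_le_mul fun a b => ?_⟩
    rw [dist_sub_left, NNReal.smul_def, NNReal.smul_def, dist_smul₀]
    have := hu.dist_le_mul a b
    simp only [NNReal.norm_eq, NNReal.coe_mul, mul_assoc]
    gcongr
  constructor
  · intro x y hxy
    refine (hc (x + t • u x)).fixedPoint_unique' (x := x) (y := y) ?_ ?_
    · simp [Function.IsFixedPt]
    · simp only at hxy
      simp [Function.IsFixedPt, hxy]
  · intro y
    refine ⟨(hc y).fixedPoint, ?_⟩
    have := (hc y).fixedPoint_isFixedPt
    exact eq_sub_iff_add_eq.1 this.eq.symm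

end Perturbation

section Retraction

variable {E : Type*} [NormedAddCommGroup E] [InnerProductSpace ℝ E] [FiniteDimensional ℝ E]

theorem det_fderiv_eq_zero_of_norm_eq_one {r : E → E} {x : E} (hr : DifferentiableAt ℝ r x)
    (hnorm : ∀ y, ‖r y‖ = 1) : (fderiv ℝ r x).det = 0 := by
  by_contra h
  have hperp (v : E) : inner ℝ (r x) (fderiv ℝ r x v) = 0 := by
    have h1 := (hr.hasFDerivAt.norm_sq).unique
      (by simpa [hnorm] using hasFDerivAt_const (1 : ℝ) x)
    have := congrArg (fun φ : E →L[ℝ] ℝ => φ v) h1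
    simpa using this
  have hu := (LinearMap.isUnit_iff_isUnit_det (fderiv ℝ r x : E →ₗ[ℝ] E)).2 (isUnit_iff_ne_zero.2 h)
  obtain ⟨v, hv⟩ := ((Module.End.isUnit_iff _).1 hu).2 (r x)
  have h2 := hperp v
  have hv' : fderiv ℝ r x v = r x := hv
  rw [hv', real_inner_self_eq_norm_sq, hnorm] at h2
  norm_num at h2

/-- The unit ball has no `C¹` retraction onto its boundary sphere. -/
theorem not_exists_contDiff_retraction_sphere :
    ¬ ∃ r : E → E, ContDiff ℝ 1 r ∧ (∀ x, ‖r x‖ = 1) ∧ ∀ x, ‖x‖ = 1 → r x = x := by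
  rintro ⟨r, hr, hnorm, hfix⟩
  borelize E
  let μ : Measure E := Measure.addHaar
  let A : E → E →L[ℝ] E := fun x => fderiv ℝ r x - 1
  have hA : Continuous A := (hr.continuous_fderiv one_ne_zero).sub continuous_const
  have hrd (x : E) : HasFDerivAt (fun y => r y - y) (A x) x :=
    ((hr.differentiable one_ne_zero x).hasFDerivAt).sub (hasFDerivAt_id x)
  obtain ⟨L, hL⟩ : ∃ L : ℝ≥0, ∀ x ∈ closedBall (0 : E) 1, ‖A x‖₊ ≤ L := by
    obtain ⟨L, hL⟩ := (isCompact_closedBall (0 : E) 1).bddAbove_image hA.nnnorm.continuousOn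
    exact ⟨L, fun x hx => hL ⟨x, hx, rfl⟩⟩
  classical
  let u : E → E := fun x => if ‖x‖ ≤ 1 then r x - x else 0
  have hu0 (x : E) (hx : 1 ≤ ‖x‖) : u x = 0 := by
    by_cases h : ‖x‖ ≤ 1
    · simp [u, h, hfix x (le_antisymm h hx)]
    · simp [u, h]
  have huL : LipschitzWith L u := by
    refine .of_lipschitzOnWith_closedBall_of_eq_zero ?_ hu0
    have h1 : LipschitzOnWith L (fun y => r y - y) (closedBall 0 1) :=
      (convex_closedBall (0 : E) 1).lipschitzOnWith_of_nnnorm_hasFDerivWithin_le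
        (fun x _ => (hrd x).hasFDerivWithinAt) hL
    intro x hx y hy
    have hx' : ‖x‖ ≤ 1 := by simpa using hx
    have hy' : ‖y‖ ≤ 1 := by simpa using hy
    simpa [u, hx', hy'] using h1 hx hy
  have hvol (t : ℝ≥0) (ht : t * L < 1) :
      ∫ x in ball 0 1, (1 + (t : ℝ) • A x).det ∂μ = μ.real (ball 0 1) := by
    have hbij := huL.bijective_add_smul ht
    have himg := image_ball_of_bijective_of_eq_self hbij (fun x hx => by simp [hu0 x hx])
    have hderiv : ∀ x ∈ ball (0 : E) 1, HasFDerivWithinAt (fun x => x + t • u x)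
        (1 + (t : ℝ) • A x) (ball 0 1) x := by
      intro x hx
      have h1 : HasFDerivAt (fun y => y + (t : ℝ) • (r y - y)) (1 + (t : ℝ) • A x) x :=
        (hasFDerivAt_id x).add ((hrd x).const_smul (t : ℝ))
      refine h1.hasFDerivWithinAt.congr (fun y hy => ?_) ?_
      · have : ‖y‖ ≤ 1 := (mem_ball_zero_iff.1 hy).le
        simp [u, this, NNReal.smul_def]
      · have : ‖x‖ ≤ 1 := (mem_ball_zero_iff.1 hx).le
        simp [u, this, NNReal.smul_def]
    have hcv := integral_image_eq_integral_abs_det_fderiv_smul μ measurableSet_ball hderiv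
      hbij.1.injOn (fun _ => (1 : ℝ))
    rw [himg] at hcv
    simp only [setIntegral_const, smul_eq_mul, mul_one] at hcv
    rw [hcv]
    refine setIntegral_congr_fun measurableSet_ball fun x hx => ?_
    have := ContinuousLinearMap.det_one_add_smul_pos (A := A x) (L := L) (t := t)
      (hL x (ball_subset_closedBall hx)) t.2 (by exact_mod_cast ht)
    exact (abs_of_pos this).symm
  have hint (t : ℝ) : IntegrableOn (fun x => (1 + t • A x).det) (ball 0 1) μ := by
    have hc : Continuous fun x => (1 + t • A x).det :=
      ContinuousLinearMap.continuous_det.comp (by fun_prop)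
    exact (hc.continuousOn.integrableOn_compact (isCompact_closedBall (0 : E) 1)).mono_set
      ball_subset_closedBall
  obtain ⟨p, hp⟩ : ∃ p : ℝ[X], ∀ t : ℝ,
      p.eval t = ∫ x in ball 0 1, (1 + t • A x).det ∂μ := by
    let s := Finset.range (Module.finrank ℝ E + 1)
    refine ⟨∑ i ∈ s, C (∫ x in ball 0 1, (1 + (i : ℝ) • A x).det ∂μ) *
      Lagrange.basis s (fun j : ℕ => (j : ℝ)) i, fun t => ?_⟩
    simp_rw [ContinuousLinearMap.det_one_add_smul_eq_sum_lagrange _ t]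
    rw [integral_finsetSum _ fun (i : ℕ) _ => (hint i).mul_const _, eval_finsetSum]
    refine Finset.sum_congr rfl fun i _ => ?_
    rw [integral_mul_const]
    simp [s]
  have hconst : p = C (μ.real (ball 0 1)) := by
    refine eq_of_infinite_eval_eq _ _ ((Ioo_infinite (a := (0 : ℝ)) (b := 1 / (L + 1))
      (by positivity)).mono fun t ht => ?_)
    have htL : t * L < 1 := by
      have h1 := (lt_div_iff₀ (by positivity)).1 ht.2
      nlinarith [ht.1]
    lift t to ℝ≥0 using ht.1.le
    have := hvol t (by exact_mod_cast htL)
    simpa [hp] using this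
  have h1 := hp 1
  have hdet (x : E) : (1 + (1 : ℝ) • A x).det = 0 := by
    have : 1 + (1 : ℝ) • A x = fderiv ℝ r x := by simp [A]
    rw [this]
    exact det_fderiv_eq_zero_of_norm_eq_one (hr.differentiable one_ne_zero x) hnorm
  simp only [hconst, eval_C, hdet, integral_zero] at h1
  exact (ENNReal.toReal_pos (measure_ball_pos μ 0 one_pos).ne' measure_ball_lt_top.ne).ne' h1

/-- A continuous map of `E` that moves no point of the unit ball by `1 / 4` or more has a zero. -/
theorem exists_eq_zero_of_norm_sub_lt {h : E → E} (hc : Continuous h)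
    (hid : ∀ x ∈ closedBall (0 : E) 1, ‖h x - x‖ < 1 / 4) : ∃ x, h x = 0 := by
  by_contra! hne
  obtain ⟨g, hg, hgh, -⟩ := hc.exists_contDiff_approx (ε := fun x => min (1 / 4) ‖h x‖) 1
    (by fun_prop) (fun x => lt_min (by norm_num) (norm_pos_iff.2 (hne x)))
  have hg0 (x : E) : g x ≠ 0 := by
    intro hx
    have := (hgh x).trans_le (min_le_right _ _)
    simp [hx] at this
  have hgid (x : E) (hx : ‖x‖ ≤ 1) : ‖g x - x‖ < 1 / 2 := by
    have h1 := (hgh x).trans_le (min_le_left _ _)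
    rw [dist_eq_norm] at h1
    have h2 := hid x (by simpa using hx)
    have h3 := norm_sub_le_norm_sub_add_norm_sub (g x) (h x) x
    linarith
  let χ : ContDiffBump (0 : E) := ⟨1 / 2, 1, by norm_num, by norm_num⟩
  let H : E → E := fun x => x + χ x • (g x - x)
  have hHd : ContDiff ℝ 1 H := contDiff_id.add (χ.contDiff.smul (hg.sub contDiff_id))
  have hHid (x : E) (hx : 1 ≤ ‖x‖) : H x = x := by
    simp [H, χ.zero_of_le_dist (x := x) (by simpa [χ] using hx)]
  have hH0 (x : E) : H x ≠ 0 := by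
    intro hx
    rcases le_total ‖x‖ (1 / 2) with h1 | h1
    · have : χ x = 1 := χ.one_of_mem_closedBall (by simpa [χ] using h1)
      exact hg0 x (by simpa [H, this] using hx)
    rcases le_total ‖x‖ 1 with h2 | h2
    · have h3 : x = -(χ x • (g x - x)) := eq_neg_of_add_eq_zero_left hx
      have h4 : ‖x‖ = χ x * ‖g x - x‖ := by
        conv_lhs => rw [h3, norm_neg, norm_smul, Real.norm_of_nonneg χ.nonneg]
      have h5 : χ x * ‖g x - x‖ ≤ ‖g x - x‖ :=
        mul_le_of_le_one_left (norm_nonneg _) χ.le_one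
      linarith [hgid x h2]
    · rw [hHid x h2] at hx
      rw [hx, norm_zero] at h2
      linarith
  refine not_exists_contDiff_retraction_sphere (E := E)
    ⟨fun x => ‖H x‖⁻¹ • H x, ?_, fun x => ?_, fun x hx => ?_⟩
  · exact ((hHd.norm ℝ hH0).inv fun x => norm_ne_zero_iff.2 (hH0 x)).smul hHd
  · rw [norm_smul, norm_inv, norm_norm, inv_mul_cancel₀ (norm_ne_zero_iff.2 (hH0 x))]
  · simp [hHid x hx.ge, hx]

/-- Invariance of dimension for continuous injections of finite-dimensional real spaces. -/
theorem not_injective_of_continuous_of_finrank_lt {F : Type*} [NormedAddCommGroup F]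
    [NormedSpace ℝ F] [FiniteDimensional ℝ F]
    (hEF : Module.finrank ℝ F < Module.finrank ℝ E) {f : E → F} (hf : Continuous f) :
    ¬ Function.Injective f := by
  intro hinj
  let B := closedBall (0 : E) 1
  have : CompactSpace B := isCompact_iff_compactSpace.1 (isCompact_closedBall 0 1)
  have hemb : Topology.IsClosedEmbedding (fun x : B => f x) :=
    (hf.comp continuous_subtype_val).isClosedEmbedding (hinj.comp Subtype.val_injective)
  have : TietzeExtension E := .of_tvs ℝ
  obtain ⟨g, hg⟩ := ContinuousMap.exists_extension hemb (⟨Subtype.val, by fun_prop⟩ : C(B, E))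
  obtain ⟨G, hG, hGg, -⟩ := g.continuous.exists_contDiff_approx (ε := fun _ => 1 / 8) 1
    (by fun_prop) (fun _ => by norm_num)
  obtain ⟨p, hpG, hp⟩ := (hG.dense_compl_range_of_finrank_lt_finrank hEF).exists_dist_lt 0
    (show (0 : ℝ) < 1 / 8 by norm_num)
  rw [dist_zero_left] at hp
  obtain ⟨x, hx⟩ := exists_eq_zero_of_norm_sub_lt (h := fun x => G (f x) - p)
    ((hG.continuous.comp hf).sub continuous_const) (fun x hx => by
      have h1 : g (f x) = x := congrArg (fun φ : C(B, E) => φ ⟨x, hx⟩) hg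
      have h2 := hGg (f x)
      rw [h1, dist_eq_norm] at h2
      have h3 := norm_sub_le (G (f x) - x) p
      rw [sub_right_comm]
      linarith)
  exact hpG ⟨f x, sub_eq_zero.1 hx⟩

end Retraction

/-- Invariance of dimension I: if `m > n` there is no continuous injection
from `ℝ^m` into `ℝ^n`. -/
theorem stmt_1 (m n : ℕ) (hmn : m > n) :
    ¬ ∃ f : (Fin m → ℝ) → (Fin n → ℝ), Continuous f ∧ Function.Injective f := by
  rintro ⟨f, hf, hinj⟩
  let e := EuclideanSpace.equiv (Fin m) ℝ
  exact not_injective_of_continuous_of_finrank_lt (E := EuclideanSpace ℝ (Fin m))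
    (by simpa using hmn) (hf.comp e.continuous) (hinj.comp e.injective)
end

section
/- For m > n, there is no topological embedding of ℝ^m into ℝ^n. -/
open Metric MeasureTheory Module Polynomial

/-- The determinant of `1 + t • A` is a polynomial in `t` of degree at most the dimension. -/
theorem exists_polynomial_eval_eq_det_one_add_smul {E : Type*} [NormedAddCommGroup E]
    [NormedSpace ℝ E] [FiniteDimensional ℝ E] (A : E →L[ℝ] E) :
    ∃ p : ℝ[X], p.degree < (finrank ℝ E + 1 : ℕ) ∧
      ∀ t : ℝ, p.eval t = (ContinuousLinearMap.id ℝ E + t • A).det := by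
  let b := finBasis ℝ E
  let M := LinearMap.toMatrix b b (A : E →ₗ[ℝ] E)
  refine ⟨Matrix.det ((X : ℝ[X]) • M.map C + (1 : Matrix _ _ ℝ).map C), ?_, fun t ↦ ?_⟩
  · refine (degree_le_natDegree).trans_lt ?_
    have := natDegree_det_X_add_C_le M 1
    rw [Fintype.card_fin] at this
    exact_mod_cast Nat.lt_succ_of_le this
  · rw [ContinuousLinearMap.det, ← LinearMap.det_toMatrix b, ← coe_evalRingHom, RingHom.map_det]
    congr 1
    ext i j
    by_cases hij : i = j <;> simp [M, LinearMap.toMatrix_apply, hij, b, mul_comm t,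
      add_comm]

/-- Evaluating a polynomial of degree less than `k` at `1` is a fixed affine combination of its
values at suitable points of `(0, ε)`. -/
theorem exists_eval_one_eq_sum (k : ℕ) {ε : ℝ} (hε : 0 < ε) :
    ∃ w v : Fin (k + 1) → ℝ, (∀ i, v i ∈ Set.Ioo 0 ε) ∧ ∑ i, w i = 1 ∧
      ∀ p : ℝ[X], p.degree < (k + 1 : ℕ) → p.eval 1 = ∑ i, w i * p.eval (v i) := by
  let v : Fin (k + 1) → ℝ := fun i ↦ ε / (i + 2)
  have hv : Set.InjOn v (Finset.univ : Finset (Fin (k + 1))) := by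
    intro i _ j _ h
    have hi : (0 : ℝ) < i + 2 := by positivity
    have hj : (0 : ℝ) < j + 2 := by positivity
    simp only [v] at h
    rw [div_eq_div_iff hi.ne' hj.ne'] at h
    have := mul_left_cancel₀ hε.ne' h
    ext
    exact_mod_cast (add_right_cancel this).symm
  have key : ∀ p : ℝ[X], p.degree < (k + 1 : ℕ) →
      p.eval 1 = ∑ i, (Lagrange.basis Finset.univ v i).eval 1 * p.eval (v i) := by
    intro p hp
    conv_lhs => rw [Lagrange.eq_interpolate (f := p) hv (by simpa using hp)]
    simp [Lagrange.interpolate_apply, eval_finsetSum, mul_comm]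
  refine ⟨fun i ↦ (Lagrange.basis Finset.univ v i).eval 1, v, fun i ↦ ⟨?_, ?_⟩, ?_, key⟩
  · positivity
  · refine div_lt_self hε ?_
    have : (0 : ℝ) ≤ i := by positivity
    linarith
  · have := key 1 (by rw [degree_one]; exact_mod_cast Nat.succ_pos k)
    simpa using this.symm

/-- There is no `C¹` retraction onto the unit sphere. -/
theorem not_exists_contDiff_retraction_sphere_s2 {E : Type*} [NormedAddCommGroup E]
    [InnerProductSpace ℝ E] [FiniteDimensional ℝ E] {r : E → E}
    (hr : ContDiff ℝ 1 r) (hnorm : ∀ x, ‖r x‖ = 1) (hsphere : ∀ x, ‖x‖ = 1 → r x = x) : False := by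
  borelize E
  have : Nontrivial E := ⟨r 0, 0, fun h ↦ by simpa [h] using hnorm 0⟩
  let u : E → E := fun x ↦ r x - x
  have hu : ContDiff ℝ 1 u := hr.sub contDiff_id
  have hdu : Continuous (fderiv ℝ u) := hu.continuous_fderiv one_ne_zero
  have hu' : ∀ x, HasFDerivAt u (fderiv ℝ u x) x := fun x ↦
    (hu.differentiable one_ne_zero x).hasFDerivAt
  obtain ⟨K, hK0, hK⟩ : ∃ K : ℝ, 0 < K ∧ ∀ x ∈ closedBall (0 : E) 1, ‖fderiv ℝ u x‖ ≤ K := by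
    obtain ⟨K, hK⟩ := (isCompact_closedBall (0 : E) 1).exists_bound_of_continuousOn hdu.continuousOn
    exact ⟨max K 1, by positivity, fun x hx ↦ (hK x hx).trans (le_max_left _ _)⟩
  obtain ⟨δ, hδ, hdet⟩ : ∃ δ > 0, ∀ L : E →L[ℝ] E, ‖L‖ < δ →
      0 < (ContinuousLinearMap.id ℝ E + L).det := by
    have hc : Continuous fun L : E →L[ℝ] E ↦ (ContinuousLinearMap.id ℝ E + L).det :=
      ContinuousLinearMap.continuous_det.comp (continuous_const.add continuous_id)
    have h0 : ∀ᶠ L in nhds (0 : E →L[ℝ] E), 0 < (ContinuousLinearMap.id ℝ E + L).det :=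
      hc.continuousAt.eventually (lt_mem_nhds (by simp [ContinuousLinearMap.det]))
    obtain ⟨δ, hδ, h⟩ := Metric.eventually_nhds_iff.1 h0
    exact ⟨δ, hδ, fun L hL ↦ h (by simpa using hL)⟩
  let F : ℝ → E → E := fun t x ↦ x + t • u x
  have hF' : ∀ t x, HasFDerivAt (F t) (ContinuousLinearMap.id ℝ E + t • fderiv ℝ u x) x :=
    fun t x ↦ (hasFDerivAt_id x).add ((hu' x).const_smul t)
  let P : ℝ → ℝ := fun t ↦
    ∫ x in ball (0 : E) 1, (ContinuousLinearMap.id ℝ E + t • fderiv ℝ u x).det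
  have hint : ∀ t : ℝ, IntegrableOn
      (fun x ↦ (ContinuousLinearMap.id ℝ E + t • fderiv ℝ u x).det) (ball (0 : E) 1) := by
    intro t
    have hc : Continuous fun x ↦ (ContinuousLinearMap.id ℝ E + t • fderiv ℝ u x).det :=
      ContinuousLinearMap.continuous_det.comp (continuous_const.add (hdu.const_smul t))
    exact (hc.continuousOn.integrableOn_compact (isCompact_closedBall _ _)).mono_set
      ball_subset_closedBall
  let ε := min 1 (min (1 / K) (δ / K))
  have hε : 0 < ε := by positivity
  have hP : ∀ t ∈ Set.Ioo 0 ε, P t = volume.real (ball (0 : E) 1) := by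
    rintro t ⟨ht0, htε⟩
    have ht1 : t < 1 := htε.trans_le (min_le_left _ _)
    have htK : t * K < 1 := (lt_div_iff₀ hK0).1
      (htε.trans_le ((min_le_right _ _).trans (min_le_left _ _)))
    have htδ : t * K < δ := (lt_div_iff₀ hK0).1
      (htε.trans_le ((min_le_right _ _).trans (min_le_right _ _)))
    have happrox : ApproximatesLinearOn (F t)
        ((ContinuousLinearEquiv.refl ℝ E : E ≃L[ℝ] E) : E →L[ℝ] E) (ball (0 : E) 1)
        (t * K).toNNReal := by
      intro x hx y hy
      have h := (convex_ball (0 : E) 1).norm_image_sub_le_of_norm_hasFDerivWithin_le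
        (fun x _ ↦ (hu' x).hasFDerivWithinAt) (fun x hx ↦ hK x (ball_subset_closedBall hx)) hy hx
      have e : F t x - F t y - (x - y) = t • (u x - u y) := by
        simp only [F, smul_sub]; abel
      simp only [ContinuousLinearEquiv.coe_coe, ContinuousLinearEquiv.refl_apply]
      rw [e, norm_smul, Real.norm_of_nonneg ht0.le, Real.coe_toNNReal _ (by positivity),
        mul_assoc]
      gcongr
    have hc : Subsingleton E ∨ (t * K).toNNReal <
        ‖((ContinuousLinearEquiv.refl ℝ E).symm : E →L[ℝ] E)‖₊⁻¹ := by
      right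
      have : ‖((ContinuousLinearEquiv.refl ℝ E).symm : E →L[ℝ] E)‖₊ = 1 := by
        ext
        exact ContinuousLinearMap.norm_id
      rw [this, inv_one]
      exact Real.toNNReal_lt_one.2 htK
    have hinj : Set.InjOn (F t) (ball 0 1) := happrox.injOn hc
    have hopen : IsOpen (F t '' ball 0 1) :=
      (happrox.toOpenPartialHomeomorph (F t) _ hc isOpen_ball).open_target
    have hFc : Continuous (F t) := continuous_id.add (hu.continuous.const_smul t)
    have hFnorm : ∀ x, F t x = (1 - t) • x + t • r x := fun x ↦ by
      simp only [F, u, smul_sub, sub_smul, one_smul]; abel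
    have hmaps : F t '' ball 0 1 ⊆ ball 0 1 := by
      rintro _ ⟨x, hx, rfl⟩
      rw [mem_ball_zero_iff] at hx ⊢
      rw [hFnorm]
      calc _ ≤ ‖(1 - t) • x‖ + ‖t • r x‖ := norm_add_le _ _
        _ = (1 - t) * ‖x‖ + t := by
          rw [norm_smul, norm_smul, hnorm, Real.norm_of_nonneg ht0.le,
            Real.norm_of_nonneg (by linarith), mul_one]
        _ < 1 := by nlinarith
    have himage : F t '' ball 0 1 = ball 0 1 := by
      refine hmaps.antisymm ?_
      refine (convex_ball (0 : E) 1).isPreconnected.subset_of_closure_inter_subset hopen ?_ ?_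
      · exact ⟨F t 0, hmaps ⟨0, by simp, rfl⟩, 0, by simp, rfl⟩
      · rintro y ⟨hy, hy1⟩
        have hcl : closure (F t '' ball 0 1) ⊆ F t '' closedBall 0 1 :=
          closure_minimal (Set.image_mono ball_subset_closedBall)
            ((isCompact_closedBall (0 : E) 1).image hFc).isClosed
        obtain ⟨x, hx, rfl⟩ := hcl hy
        rcases (mem_closedBall_zero_iff.1 hx).lt_or_eq with h | h
        · exact ⟨x, mem_ball_zero_iff.2 h, rfl⟩
        · have : F t x = x := by simp [F, u, hsphere x h]
          rw [this, mem_ball_zero_iff] at hy1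
          exact absurd h hy1.ne
    have hcv := integral_image_eq_integral_abs_det_fderiv_smul volume
      (measurableSet_ball (x := (0 : E)) (ε := 1))
      (fun x _ ↦ (hF' t x).hasFDerivWithinAt) hinj (fun _ ↦ (1 : ℝ))
    rw [himage] at hcv
    simp only [smul_eq_mul, mul_one, setIntegral_const] at hcv
    rw [hcv]
    refine setIntegral_congr_fun measurableSet_ball fun x hx ↦ ?_
    refine (abs_of_pos (hdet _ ?_)).symm
    rw [norm_smul, Real.norm_of_nonneg ht0.le]
    exact (mul_le_mul_of_nonneg_left (hK x (ball_subset_closedBall hx)) ht0.le).trans_lt htδ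
  have hP1 : P 1 = volume.real (ball (0 : E) 1) := by
    obtain ⟨w, v, hv, hw, hp⟩ := exists_eval_one_eq_sum (finrank ℝ E) hε
    calc P 1 = ∫ x in ball (0 : E) 1, ∑ i, w i *
          (ContinuousLinearMap.id ℝ E + v i • fderiv ℝ u x).det := by
          refine setIntegral_congr_fun measurableSet_ball fun x _ ↦ ?_
          obtain ⟨p, hdeg, heval⟩ := exists_polynomial_eval_eq_det_one_add_smul (fderiv ℝ u x)
          simp only [← heval]
          exact hp p hdeg
      _ = ∑ i, w i * P (v i) := by
          rw [integral_finsetSum _ fun i _ ↦ (hint (v i)).const_mul (w i)]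
          simp only [integral_const_mul, P]
      _ = volume.real (ball (0 : E) 1) := by
          simp only [fun i ↦ hP (v i) (hv i), ← Finset.sum_mul, hw, one_mul]
  have hP0 : P 1 = 0 := by
    refine setIntegral_eq_zero_of_forall_eq_zero fun x _ ↦ ?_
    by_contra hne
    have hr' : HasFDerivAt r (ContinuousLinearMap.id ℝ E + (1 : ℝ) • fderiv ℝ u x) x := by
      have : F 1 = r := by ext x; simp [F, u]
      exact this ▸ hF' 1 x
    let e := ContinuousLinearMap.toContinuousLinearEquivOfDetNeZero _ hne
    have hconst : HasFDerivAt (fun y ↦ inner ℝ (r y) (r y)) (0 : E →L[ℝ] ℝ) x := by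
      simp only [real_inner_self_eq_norm_sq, hnorm]
      exact hasFDerivAt_const _ _
    have h := congrArg (fun L : E →L[ℝ] ℝ ↦ L (e.symm (r x)))
      ((hr'.inner ℝ hr').unique hconst)
    have he : (ContinuousLinearMap.id ℝ E + (1 : ℝ) • fderiv ℝ u x) (e.symm (r x)) = r x :=
      e.apply_symm_apply (r x)
    simp only [ContinuousLinearMap.comp_apply, ContinuousLinearMap.prod_apply, he,
      fderivInnerCLM_apply, zero_apply, real_inner_self_eq_norm_sq,
      hnorm] at h
    norm_num at h
  have hpos : 0 < volume.real (ball (0 : E) 1) :=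
    ENNReal.toReal_pos (measure_ball_pos _ _ one_pos).ne' measure_ball_lt_top.ne
  linarith

/-- A continuous self-map of a Euclidean space that is close to the identity on the unit ball has
a zero. -/
theorem exists_eq_zero_of_norm_sub_le {E : Type*} [NormedAddCommGroup E]
    [InnerProductSpace ℝ E] [FiniteDimensional ℝ E] [Nontrivial E] {k : E → E} (hk : Continuous k)
    (hclose : ∀ x, ‖x‖ ≤ 1 → ‖k x - x‖ ≤ 1 / 4) : ∃ x, k x = 0 := by
  by_contra! hne
  obtain ⟨q, hq, hqk, -⟩ := hk.exists_contDiff_approx 1 (ε := fun x ↦ min ‖k x‖ (1 / 4))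
    (hk.norm.min continuous_const) fun x ↦ lt_min (norm_pos_iff.2 (hne x)) (by norm_num)
  have hq0 : ∀ x, q x ≠ 0 := fun x h ↦ by
    have := (hqk x).trans_le (min_le_left _ _)
    simp [h] at this
  have hqx : ∀ x, ‖x‖ ≤ 1 → ‖q x - x‖ < 1 / 2 := fun x hx ↦ by
    have h1 := (hqk x).trans_le (min_le_right _ _)
    rw [dist_eq_norm] at h1
    calc ‖q x - x‖ = ‖(q x - k x) + (k x - x)‖ := by congr 1; abel
      _ ≤ ‖q x - k x‖ + ‖k x - x‖ := norm_add_le _ _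
      _ < 1 / 2 := by linarith [hclose x hx]
  let ψ : ContDiffBump (0 : E) := ⟨1 / 2, 1, by norm_num, by norm_num⟩
  let h : E → E := fun x ↦ x + ψ x • (q x - x)
  have hh : ContDiff ℝ 1 h :=
    contDiff_id.add (ψ.contDiff.smul (hq.sub contDiff_id))
  have hout : ∀ x, 1 ≤ ‖x‖ → h x = x := fun x hx ↦ by
    have : ψ x = 0 := ψ.zero_of_le_dist (by simpa [ψ] using hx)
    simp [h, this]
  have hh0 : ∀ x, h x ≠ 0 := by
    intro x hx
    rcases le_total 1 ‖x‖ with h1 | h1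
    · rw [hout x h1] at hx
      simp [hx] at h1
      linarith
    rcases le_total ‖x‖ (1 / 2) with h2 | h2
    · have : ψ x = 1 := ψ.one_of_mem_closedBall (by simpa [ψ] using h2)
      exact hq0 x (by simpa [h, this] using hx)
    · have hx' : ‖x‖ = ‖ψ x • (q x - x)‖ := by
        simpa only [norm_neg] using congrArg norm (eq_neg_of_add_eq_zero_left hx)
      rw [norm_smul, Real.norm_of_nonneg ψ.nonneg] at hx'
      have := mul_le_of_le_one_left (norm_nonneg (q x - x)) (ψ.le_one (x := x))
      linarith [hqx x h1]
  refine not_exists_contDiff_retraction_sphere_s2 (r := fun x ↦ ‖h x‖⁻¹ • h x)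
    (((hh.norm ℝ hh0).inv fun x ↦ norm_ne_zero_iff.2 (hh0 x)).smul hh) (fun x ↦ ?_) fun x hx ↦ ?_
  · rw [norm_smul, norm_inv, norm_norm, inv_mul_cancel₀ (norm_ne_zero_iff.2 (hh0 x))]
  · simp [hout x hx.ge, hx]

/-- Invariance of dimension II: if `m > n` there is no topological embedding
of `ℝ^m` into `ℝ^n`. -/
theorem stmt_2 (m n : ℕ) (hmn : m > n) :
    ¬ ∃ f : (Fin m → ℝ) → (Fin n → ℝ), Topology.IsEmbedding f := by
  rintro ⟨f₀, hf₀⟩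
  let E := EuclideanSpace ℝ (Fin m)
  let f : E → Fin n → ℝ := f₀ ∘ EuclideanSpace.equiv (Fin m) ℝ
  have hf : Topology.IsEmbedding f :=
    hf₀.comp (EuclideanSpace.equiv (Fin m) ℝ).toHomeomorph.isEmbedding
  have : Nontrivial E := Module.nontrivial_of_finrank_pos (R := ℝ) (by simp [E]; omega)
  have hclosed : Topology.IsClosedEmbedding fun x : closedBall (0 : E) 1 ↦ f x :=
    have : CompactSpace (closedBall (0 : E) 1) :=
      isCompact_iff_compactSpace.1 (isCompact_closedBall _ _)
    (hf.continuous.comp continuous_subtype_val).isClosedEmbedding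
      (hf.injective.comp Subtype.val_injective)
  obtain ⟨g, hg⟩ := ContinuousMap.exists_extension' hclosed
    (⟨Subtype.val, continuous_subtype_val⟩ : C(closedBall (0 : E) 1, E))
  have hgf : ∀ x : E, ‖x‖ ≤ 1 → g (f x) = x := fun x hx ↦
    congrFun hg ⟨x, mem_closedBall_zero_iff.2 hx⟩
  obtain ⟨p, hp, hpg, -⟩ := g.continuous.exists_contDiff_approx 1 (ε := fun _ ↦ 1 / 8)
    continuous_const fun _ ↦ by norm_num
  obtain ⟨y, hy, hyp⟩ := (hp.dense_compl_range_of_finrank_lt_finrank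
    (by simpa [E] using hmn)).exists_dist_lt (0 : E) (ε := 1 / 8) (by norm_num)
  rw [dist_zero_left] at hyp
  obtain ⟨x, hx⟩ := exists_eq_zero_of_norm_sub_le (k := fun x : E ↦ p (f x) - y)
    ((hp.continuous.comp hf.continuous).sub continuous_const) fun x hx ↦ by
      have h := hpg (f x)
      rw [hgf x hx, dist_eq_norm] at h
      calc ‖p (f x) - y - x‖ = ‖(p (f x) - x) - y‖ := by congr 1; abel
        _ ≤ ‖p (f x) - x‖ + ‖y‖ := norm_sub_le _ _
        _ ≤ 1 / 4 := by linarith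
  exact hy ⟨f x, sub_eq_zero.1 hx⟩
end
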